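/- Let η_1, …, η_k (k ≥ 1) be parameters over A such that each matrix g_{s,j} := I_{p(s)} + η_j^{s,0} is invertible in the ring of p(s) × p(s) matrices over A. Set g_s(l) := g_{s,1} · g_{s,2} ⋯ g_{s,l} for 0 ≤ l ≤ k (ordered product, with g_s(0) := I_{p(s)}), and η(k) := η_1 ∧ η_2 ∧ ⋯ ∧ η_k (ordered ∧-product of parameters). Then for every 0 ≤ s ≤ m and 1 ≤ t ≤ m−s one has η(k)^{s,t} = ( Σ_{τ ∈ Δ_t} Σ_{J ∈ J_k(ρ(τ))} ∏_{r=1}^{ρ(τ)} g_{s+σ'(τ,r)}(j_r − 1) · η_{j_r}^{s+σ(τ,r), τ_{ρ(τ)+1−r}} · g_{s+σ(τ,r)}(j_r)^{−1} ) · g_s(k), where the product over r = 1, …, ρ(τ) is taken in increasing order of r. -/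

import Mathlib

/-- Cast of a rectangular matrix along equalities of its dimensions (junk value 0 if the
    dimensions do not agree). -/
def mcast {A : Type*} [Ring A] (a c : ℕ) {b d : ℕ} (M : Matrix (Fin b) (Fin d) A) :
    Matrix (Fin a) (Fin c) A :=
  if h : b = a ∧ d = c then M.submatrix (Fin.cast h.1.symm) (Fin.cast h.2.symm) else 0

/-- A parameter over the ring A relative to the dimension family p: a family of
    p(s+t) × p(s) matrices η^{s,t}. -/
def Param (A : Type*) [Ring A] (p : ℕ → ℕ) : Type _ :=
  ∀ s t : ℕ, Matrix (Fin (p (s + t))) (Fin (p s)) A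

/-- The support convention: η^{s,t} = 0 outside 0 ≤ s ≤ m, 0 ≤ t ≤ m − s. -/
def InRange {A : Type*} [Ring A] {p : ℕ → ℕ} (m : ℕ) (η : Param A p) : Prop :=
  ∀ s t : ℕ, m < s + t → η s t = 0

/-- The product (η₁ ∧ η₂)^{s,t} := η₁^{s,t} + η₂^{s,t} + Σ_{j=0}^{t} η₁^{s+j,t−j}·η₂^{s,j}. -/
def wedge {A : Type*} [Ring A] (p : ℕ → ℕ) (η₁ η₂ : Param A p) : Param A p :=
  fun s t =>
    η₁ s t + η₂ s t +
      ∑ j ∈ Finset.range (t + 1), mcast (p (s + t)) (p s) (η₁ (s + j) (t - j) * η₂ s j)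

/-- η(k) := η₁ ∧ η₂ ∧ ⋯ ∧ η_k (ordered product, η(0) := 0). -/
def etaProd {A : Type*} [Ring A] (p : ℕ → ℕ) (η : ℕ → Param A p) : ℕ → Param A p
  | 0 => fun _ _ => 0
  | k + 1 => wedge p (etaProd p η k) (η (k + 1))

/-- g_s(l) := g_{s,1}·g_{s,2}⋯g_{s,l}, the ordered product of the matrices
    g_{s,j} := I + η_j^{s,0} (with g_s(0) = I). -/
def gProd {A : Type*} [Ring A] (p : ℕ → ℕ) (η : ℕ → Param A p) (s : ℕ) :
    ℕ → Matrix (Fin (p s)) (Fin (p s)) A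
  | 0 => 1
  | l + 1 =>
    gProd p η s l * (1 + show Matrix (Fin (p s)) (Fin (p s)) A from η (l + 1) s 0)

/-- Ordered product F a · F (a+1) ⋯ F (a+n−1) of a chain of composable rectangular
    matrices, of size dim a × dim (a+n). -/
def chainProd {A : Type*} [Ring A] (dim : ℕ → ℕ)
    (F : ∀ r : ℕ, Matrix (Fin (dim r)) (Fin (dim (r + 1))) A) :
    ∀ (a nn : ℕ), Matrix (Fin (dim a)) (Fin (dim (a + nn))) A
  | a, 0 => show Matrix (Fin (dim a)) (Fin (dim (a + 0))) A from
      (1 : Matrix (Fin (dim a)) (Fin (dim a)) A)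
  | a, nn + 1 => chainProd dim F a nn * F (a + nn)

/-- The set Δ_t of τ ∈ ℕ^t with Σ τ_j = t whose support is an initial segment
    (τ_j ≠ 0 ⟹ τ_{j−1} ≠ 0); entries are recorded as elements of Fin (t+1), which is
    harmless since each entry is at most t.  Index i : Fin t stands for the (i+1)-st
    (1-based) entry. -/
def DeltaSet (t : ℕ) : Finset (Fin t → Fin (t + 1)) :=
  Finset.univ.filter fun τ =>
    (∑ j, (τ j : ℕ)) = t ∧ ∀ i j : Fin t, (i : ℕ) + 1 = (j : ℕ) → τ j ≠ 0 → τ i ≠ 0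

/-- The 1-based entry τ_j of τ (zero outside 1 ≤ j ≤ t). -/
def tval {t : ℕ} (τ : Fin t → Fin (t + 1)) (j : ℕ) : ℕ :=
  if h : 1 ≤ j ∧ j ≤ t then (τ ⟨j - 1, by omega⟩ : ℕ) else 0

/-- ρ(τ) := max{ j : τ_j ≠ 0 } (1-based). -/
def rhoOf {t : ℕ} (τ : Fin t → Fin (t + 1)) : ℕ :=
  (Finset.univ.filter fun j => τ j ≠ 0).sup fun j : Fin t => (j : ℕ) + 1

/-- σ'(τ,r) := Σ_{j=1}^{ρ(τ)+1−r} τ_j. -/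
def sigma' {t : ℕ} (τ : Fin t → Fin (t + 1)) (r : ℕ) : ℕ :=
  ∑ j ∈ Finset.Icc 1 (rhoOf τ + 1 - r), tval τ j

/-- σ(τ,r) := Σ_{j=1}^{ρ(τ)−r} τ_j. -/
def sigmaOf {t : ℕ} (τ : Fin t → Fin (t + 1)) (r : ℕ) : ℕ :=
  ∑ j ∈ Finset.Icc 1 (rhoOf τ - r), tval τ j

/-- J_k(ρ) : the strictly increasing ρ-tuples with values in {1,…,k}, encoded as strictly
    monotone maps Fin ρ → Fin k (this set is empty when k < ρ). -/
def Jset (k ρ : ℕ) : Finset (Fin ρ → Fin k) :=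
  Finset.univ.filter fun J => ∀ q q' : Fin ρ, q < q' → J q < J q'

/-- The 1-based r-th member j_r ∈ {1,…,k} of the tuple J (zero outside 1 ≤ r ≤ ρ). -/
def jval {k ρ : ℕ} (J : Fin ρ → Fin k) (r : ℕ) : ℕ :=
  if h : 1 ≤ r ∧ r ≤ ρ then (J ⟨r - 1, by omega⟩ : ℕ) + 1 else 0

section Cast

variable {A : Type*} [Ring A]

theorem mcast_self {a c : ℕ} (M : Matrix (Fin a) (Fin c) A) : mcast a c M = M := by
  ext i j
  simp [mcast]

theorem mcast_mcast {a b c d e f : ℕ} (M : Matrix (Fin e) (Fin f) A) (h₁ : e = b)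
    (h₂ : f = d) : mcast a c (mcast b d M) = mcast a c M := by
  subst h₁ h₂
  rw [mcast_self]

theorem mcast_mul {a b c d d' e : ℕ} (M : Matrix (Fin b) (Fin d) A)
    (N : Matrix (Fin d) (Fin e) A) (h₁ : b = a) (h₂ : d = d') (h₃ : e = c) :
    mcast a c (M * N) = mcast a d' M * mcast d' c N := by
  subst h₁ h₂ h₃
  simp only [mcast_self]

theorem mcast_mul_right {a b c d : ℕ} (M : Matrix (Fin b) (Fin d) A)
    (N : Matrix (Fin d) (Fin c) A) (h : b = a) :
    mcast a c (M * N) = mcast a d M * N := by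
  rw [mcast_mul M N h rfl rfl, mcast_self N]

theorem mcast_sum {ι : Type*} (S : Finset ι) {a b c d : ℕ}
    (f : ι → Matrix (Fin b) (Fin d) A) (h₁ : b = a) (h₂ : d = c) :
    mcast a c (∑ i ∈ S, f i) = ∑ i ∈ S, mcast a c (f i) := by
  subst h₁ h₂
  simp only [mcast_self]

theorem chainProd_congr {dim dim' : ℕ → ℕ}
    {F : ∀ r : ℕ, Matrix (Fin (dim r)) (Fin (dim (r + 1))) A}
    {F' : ∀ r : ℕ, Matrix (Fin (dim' r)) (Fin (dim' (r + 1))) A} (a n : ℕ)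
    (hdim : ∀ r, a ≤ r → r ≤ a + n → dim' r = dim r)
    (hF : ∀ r, a ≤ r → r < a + n → F r = mcast _ _ (F' r)) :
    chainProd dim F a n = mcast _ _ (chainProd dim' F' a n) := by
  induction n with
  | zero =>
    have h := hdim a le_rfl le_rfl
    change (1 : Matrix (Fin (dim a)) (Fin (dim a)) A) =
      mcast _ _ (1 : Matrix (Fin (dim' a)) (Fin (dim' a)) A)
    generalize dim a = x at h ⊢
    subst h
    rw [mcast_self]
  | succ n ih =>
    have h := ih (fun r h₁ h₂ => hdim r h₁ (by omega)) (fun r h₁ h₂ => hF r h₁ (by omega))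
    change chainProd dim F a n * F (a + n) = mcast _ _ (chainProd dim' F' a n * F' (a + n))
    rw [mcast_mul _ _ (hdim a le_rfl (by omega)) (hdim (a + n) (by omega) (by omega))
      (hdim (a + n + 1) (by omega) (by omega)), h, hF (a + n) (by omega) (by omega)]

end Cast

section Index

/-- `(ρ, v, j)` encodes a composition `v 1 + ⋯ + v ρ = t` into positive parts together with
a strictly increasing tuple `j 1 < ⋯ < j ρ` in `{1, …, k}`; both sequences are extended by
zero. -/
structure IsChainIndex (k t : ℕ) (x : ℕ × (ℕ → ℕ) × (ℕ → ℕ)) : Prop where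
  part_ne_zero_iff : ∀ r, x.2.1 r ≠ 0 ↔ 1 ≤ r ∧ r ≤ x.1
  sum_eq : ∑ r ∈ Finset.Icc 1 x.1, x.2.1 r = t
  label_ne_zero_iff : ∀ r, x.2.2 r ≠ 0 ↔ 1 ≤ r ∧ r ≤ x.1
  label_le : ∀ r, x.2.2 r ≤ k
  label_lt : ∀ r r', 1 ≤ r → r < r' → r' ≤ x.1 → x.2.2 r < x.2.2 r'

theorem tval_succ {t : ℕ} (τ : Fin t → Fin (t + 1)) (i : Fin t) :
    tval τ (i + 1) = τ i := by
  have := i.2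
  rw [tval, dif_pos (by omega)]
  rfl

theorem jval_succ {k ρ : ℕ} (J : Fin ρ → Fin k) (i : Fin ρ) : jval J (i + 1) = J i + 1 := by
  have := i.2
  rw [jval, dif_pos (by omega)]
  rfl

theorem tval_injective {t : ℕ} :
    Function.Injective (tval : (Fin t → Fin (t + 1)) → ℕ → ℕ) := fun τ τ' h => by
  ext i
  rw [← tval_succ, ← tval_succ, h]

theorem jval_injective {k ρ : ℕ} :
    Function.Injective (jval : (Fin ρ → Fin k) → ℕ → ℕ) := fun J J' h => by
  ext i
  have := congrFun h (i + 1)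
  rw [jval_succ, jval_succ] at this
  omega

theorem le_rhoOf {t : ℕ} {τ : Fin t → Fin (t + 1)} {r : ℕ} (h : tval τ r ≠ 0) :
    1 ≤ r ∧ r ≤ rhoOf τ := by
  unfold tval at h
  split_ifs at h with hr
  · refine ⟨hr.1, ?_⟩
    have := Finset.le_sup (f := fun j : Fin t => (j : ℕ) + 1)
      (s := Finset.univ.filter fun j => τ j ≠ 0) (b := ⟨r - 1, by omega⟩)
      (by simp only [Finset.mem_filter, Finset.mem_univ, true_and]
          intro h0
          exact h (by rw [h0]; rfl))
    change r - 1 + 1 ≤ rhoOf τ at this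
    omega
  · exact absurd rfl h

theorem rhoOf_le {t : ℕ} {τ : Fin t → Fin (t + 1)} {n : ℕ}
    (h : ∀ r, tval τ r ≠ 0 → r ≤ n) : rhoOf τ ≤ n := by
  refine Finset.sup_le fun i hi => h _ ?_
  rw [tval_succ]
  exact fun h => (Finset.mem_filter.1 hi).2 (Fin.ext h)

theorem tval_rhoOf_ne_zero {t : ℕ} (τ : Fin t → Fin (t + 1)) (h : rhoOf τ ≠ 0) :
    tval τ (rhoOf τ) ≠ 0 := by
  intro h0
  have : rhoOf τ ≤ rhoOf τ - 1 := rhoOf_le fun r hr => by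
    have h₁ := le_rhoOf hr
    have h₂ : r ≠ rhoOf τ := fun h => hr (h ▸ h0)
    omega
  omega

theorem sum_tval {t : ℕ} (τ : Fin t → Fin (t + 1)) :
    ∑ r ∈ Finset.Icc 1 (rhoOf τ), tval τ r = ∑ i, (τ i : ℕ) := by
  have hle : rhoOf τ ≤ t := rhoOf_le fun r hr => by
    unfold tval at hr
    split_ifs at hr with h
    · exact h.2
    · exact absurd rfl hr
  rw [Finset.sum_subset (Finset.Icc_subset_Icc_right hle)
    (fun r h₁ h₂ => by
      by_contra h
      exact h₂ (Finset.mem_Icc.2 (le_rhoOf h)))]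
  rw [← Finset.sum_congr rfl (fun i _ => tval_succ τ i),
    Fin.sum_univ_eq_sum_range (fun i => tval τ (i + 1)), Finset.range_eq_Ico,
    Finset.sum_Ico_add' (fun i => tval τ i) 0 t 1]
  rfl

theorem tval_ne_zero_iff {t : ℕ} {τ : Fin t → Fin (t + 1)} (hτ : τ ∈ DeltaSet t) (r : ℕ) :
    tval τ r ≠ 0 ↔ 1 ≤ r ∧ r ≤ rhoOf τ := by
  refine ⟨le_rhoOf, fun ⟨h₁, h₂⟩ => ?_⟩
  simp only [DeltaSet, Finset.mem_filter, Finset.mem_univ, true_and] at hτ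
  induction h₂ using Nat.decreasingInduction with
  | self => exact tval_rhoOf_ne_zero τ (by omega)
  | of_succ r hr ih =>
    have h : tval τ (r + 1) ≠ 0 := by apply ih <;> omega
    have hrt : r + 1 ≤ t := by
      by_contra hrt
      exact h (dif_neg (by omega))
    have := hτ.2 ⟨r - 1, by omega⟩ ⟨r, by omega⟩ (by simp only; omega)
      (by
        have e := tval_succ τ ⟨r, by omega⟩
        simp only at e
        rw [e] at h
        exact fun h0 => h (Fin.ext_iff.1 h0))
    have e := tval_succ τ ⟨r - 1, by omega⟩
    simp only [Nat.sub_add_cancel h₁] at e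
    rw [e]
    exact fun h0 => this (Fin.ext h0)

theorem isChainIndex_of_mem {k t : ℕ} {τ : Fin t → Fin (t + 1)} (hτ : τ ∈ DeltaSet t)
    {J : Fin (rhoOf τ) → Fin k} (hJ : J ∈ Jset k (rhoOf τ)) :
    IsChainIndex k t (rhoOf τ, tval τ, jval J) where
  part_ne_zero_iff := tval_ne_zero_iff hτ
  sum_eq := by
    simp only [DeltaSet, Finset.mem_filter] at hτ
    exact (sum_tval τ).trans hτ.2.1
  label_ne_zero_iff r := by
    simp only [jval]
    split_ifs with h <;> simp [h]
  label_le r := by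
    simp only [jval]
    split_ifs with h
    · exact (J _).2
    · exact Nat.zero_le _
  label_lt r r' h₁ h₂ h₃ := by
    simp only [Jset, Finset.mem_filter] at hJ
    simp only at h₃
    have := hJ.2 ⟨r - 1, by omega⟩ ⟨r' - 1, by omega⟩ (by simp only [Fin.mk_lt_mk]; omega)
    rw [Fin.lt_def] at this
    simp only [jval]
    rw [dif_pos (by omega), dif_pos (by omega)]
    omega

theorem IsChainIndex.exists_mem {k t : ℕ} {x : ℕ × (ℕ → ℕ) × (ℕ → ℕ)}
    (hx : IsChainIndex k t x) :
    ∃ τ ∈ DeltaSet t, ∃ J ∈ Jset k (rhoOf τ), (rhoOf τ, tval τ, jval J) = x := by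
  obtain ⟨ρ, v, j⟩ := x
  obtain ⟨hv, hs, hj, hk, hlt⟩ := hx
  simp only at hv hs hj hk hlt
  have hρ : ρ ≤ t := by
    have := Finset.card_nsmul_le_sum (Finset.Icc 1 ρ) v 1 (fun r hr =>
      Nat.one_le_iff_ne_zero.2 ((hv r).2 (Finset.mem_Icc.1 hr)))
    simpa [hs] using this
  have hvt (r : ℕ) : v r ≤ t := by
    by_cases h : v r = 0
    · omega
    · rw [← hs]
      exact Finset.single_le_sum (f := v) (fun _ _ => Nat.zero_le _)
        (Finset.mem_Icc.2 ((hv r).1 h))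
  let τ : Fin t → Fin (t + 1) := fun i => ⟨v (i + 1), Nat.lt_succ_of_le (hvt _)⟩
  have hτv : tval τ = v := by
    funext r
    unfold tval
    split_ifs with h
    · simp only [τ]
      rw [Nat.sub_add_cancel h.1]
    · by_contra h'
      have := (hv r).1 (Ne.symm h')
      omega
  have hτρ : rhoOf τ = ρ := by
    apply le_antisymm
    · exact rhoOf_le fun r hr => ((hv r).1 (by rwa [hτv] at hr)).2
    · rcases Nat.eq_zero_or_pos ρ with h | h
      · omega
      · exact (le_rhoOf (by rw [hτv]; exact (hv ρ).2 ⟨h, le_rfl⟩)).2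
  have hjJ (i : Fin (rhoOf τ)) : j (i + 1) - 1 < k := by
    have h₁ := hk (i + 1)
    have h₂ := (hj (i + 1)).2 ⟨by omega, by have := i.2; omega⟩
    omega
  refine ⟨τ, ?_, fun i => ⟨j (i + 1) - 1, hjJ i⟩, ?_, ?_⟩
  · simp only [DeltaSet, Finset.mem_filter, Finset.mem_univ, true_and]
    refine ⟨by rw [← sum_tval, hτρ, hτv, hs], fun a b hab hb => ?_⟩
    have hb' : v (b + 1) ≠ 0 := fun h => hb (Fin.ext h)
    have h₁ := (hv _).1 hb'
    have h₂ := (hv (a + 1)).2 ⟨by omega, by omega⟩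
    exact fun h => h₂ (Fin.ext_iff.1 h)
  · simp only [Jset, Finset.mem_filter, Finset.mem_univ, true_and, Fin.mk_lt_mk]
    intro a b hab
    have hb := b.2
    rw [Fin.lt_def] at hab
    have h₁ := hlt (a + 1) (b + 1) (by omega) (by omega) (by omega)
    have h₂ := (hj (a + 1)).2 ⟨by omega, by omega⟩
    omega
  · refine Prod.ext hτρ (Prod.ext hτv ?_)
    funext r
    simp only [jval]
    split_ifs with h
    · rw [Nat.sub_add_cancel h.1]
      have := (hj r).2 (by omega)
      omega
    · by_contra h'
      have := (hj r).1 (Ne.symm h')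
      omega

open Classical in
/-- The set of all triples `(ρ(τ), τ, J)` with `τ ∈ Δ_t` and `J ∈ J_k(ρ(τ))`. -/
noncomputable def chainIndices (k t : ℕ) : Finset (ℕ × (ℕ → ℕ) × (ℕ → ℕ)) :=
  ((DeltaSet t).sigma fun τ => Jset k (rhoOf τ)).image
    fun x => (rhoOf x.1, tval x.1, jval x.2)

theorem mem_chainIndices {k t : ℕ} {x : ℕ × (ℕ → ℕ) × (ℕ → ℕ)} :
    x ∈ chainIndices k t ↔ IsChainIndex k t x := by
  simp only [chainIndices, Finset.mem_image, Finset.mem_sigma]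
  constructor
  · rintro ⟨⟨τ, J⟩, ⟨hτ, hJ⟩, rfl⟩
    exact isChainIndex_of_mem hτ hJ
  · intro h
    obtain ⟨τ, hτ, J, hJ, h⟩ := h.exists_mem
    exact ⟨⟨τ, J⟩, ⟨hτ, hJ⟩, h⟩

theorem sum_chainIndices {M : Type*} [AddCommMonoid M] (k t : ℕ)
    (f : ℕ × (ℕ → ℕ) × (ℕ → ℕ) → M) :
    ∑ x ∈ chainIndices k t, f x =
      ∑ τ ∈ DeltaSet t, ∑ J ∈ Jset k (rhoOf τ), f (rhoOf τ, tval τ, jval J) := by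
  classical
  rw [chainIndices, Finset.sum_image, Finset.sum_sigma]
  rintro ⟨τ, J⟩ - ⟨τ', J'⟩ - h
  simp only [Prod.mk.injEq] at h
  obtain rfl := tval_injective h.2.1
  obtain rfl := jval_injective h.2.2
  rfl

/-- Prepend the part `a` to the composition and append the label `l` to the tuple. -/
def extendIndex (a l : ℕ) (x : ℕ × (ℕ → ℕ) × (ℕ → ℕ)) : ℕ × (ℕ → ℕ) × (ℕ → ℕ) :=
  (x.1 + 1, fun r => if r = 0 then 0 else if r = 1 then a else x.2.1 (r - 1),
    Function.update x.2.2 (x.1 + 1) l)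

/-- Remove the first part of the composition and the last label of the tuple. -/
def shrinkIndex (x : ℕ × (ℕ → ℕ) × (ℕ → ℕ)) : ℕ × (ℕ → ℕ) × (ℕ → ℕ) :=
  (x.1 - 1, fun r => if r = 0 then 0 else x.2.1 (r + 1), Function.update x.2.2 x.1 0)

theorem sum_extendIndex (a l n : ℕ) (x : ℕ × (ℕ → ℕ) × (ℕ → ℕ)) :
    ∑ r ∈ Finset.Icc 1 (n + 1), (extendIndex a l x).2.1 r =
      a + ∑ r ∈ Finset.Icc 1 n, x.2.1 r := by
  induction n with
  | zero => simp [extendIndex]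
  | succ n ih =>
    rw [Finset.sum_Icc_succ_top (by omega), ih, Finset.sum_Icc_succ_top (by omega)]
    simp [extendIndex, add_assoc]

theorem IsChainIndex.extend {k t a : ℕ} (h₁ : 1 ≤ a) (h₂ : a ≤ t)
    {x : ℕ × (ℕ → ℕ) × (ℕ → ℕ)} (hx : IsChainIndex k (t - a) x) :
    IsChainIndex (k + 1) t (extendIndex a (k + 1) x) where
  part_ne_zero_iff r := by
    have := hx.part_ne_zero_iff (r - 1)
    simp only [extendIndex]
    split_ifs <;> omega
  sum_eq := by
    change ∑ r ∈ Finset.Icc 1 (x.1 + 1), _ = t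
    rw [sum_extendIndex, hx.sum_eq]
    omega
  label_ne_zero_iff r := by
    have := hx.label_ne_zero_iff r
    simp only [extendIndex, Function.update_apply]
    split_ifs <;> omega
  label_le r := by
    have := hx.label_le r
    simp only [extendIndex, Function.update_apply]
    split_ifs <;> omega
  label_lt r r' h₁ h₂ h₃ := by
    have h := hx.label_lt r r' h₁ h₂
    have := hx.label_le r
    simp only [extendIndex, Function.update_apply] at h₃ ⊢
    split_ifs <;> omega

theorem extendIndex_shrinkIndex {k t : ℕ} {x : ℕ × (ℕ → ℕ) × (ℕ → ℕ)}
    (hx : IsChainIndex (k + 1) t x) (hl : x.2.2 x.1 = k + 1) :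
    extendIndex (x.2.1 1) (k + 1) (shrinkIndex x) = x := by
  have h0 := (hx.label_ne_zero_iff x.1).1 (by omega)
  refine Prod.ext ?_ (Prod.ext ?_ ?_)
  · simp only [extendIndex, shrinkIndex]
    omega
  · funext r
    have := hx.part_ne_zero_iff 0
    simp only [extendIndex, shrinkIndex]
    rcases r with _ | _ | r
    · simpa [eq_comm] using this
    · simp
    · simp
  · simp only [extendIndex, shrinkIndex, Nat.sub_add_cancel h0.1, Function.update_idem]
    rw [← hl, Function.update_eq_self]

theorem shrinkIndex_extendIndex {k t a l : ℕ} {x : ℕ × (ℕ → ℕ) × (ℕ → ℕ)}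
    (hx : IsChainIndex k t x) : shrinkIndex (extendIndex a l x) = x := by
  refine Prod.ext rfl (Prod.ext ?_ ?_)
  · funext r
    have := hx.part_ne_zero_iff 0
    rcases r with _ | r
    · simpa [extendIndex, shrinkIndex, eq_comm] using this
    · simp [extendIndex, shrinkIndex]
  · have := hx.label_ne_zero_iff (x.1 + 1)
    simp only [extendIndex, shrinkIndex, Function.update_idem]
    rw [Function.update_eq_self_iff]
    omega

theorem IsChainIndex.shrink {k t : ℕ} {x : ℕ × (ℕ → ℕ) × (ℕ → ℕ)}
    (hx : IsChainIndex (k + 1) t x) (hl : x.2.2 x.1 = k + 1) :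
    IsChainIndex k (t - x.2.1 1) (shrinkIndex x) where
  part_ne_zero_iff r := by
    have := hx.part_ne_zero_iff (r + 1)
    simp only [shrinkIndex]
    split_ifs <;> omega
  sum_eq := by
    have h0 := (hx.label_ne_zero_iff x.1).1 (by omega)
    have h := hx.sum_eq
    conv_lhs at h => rw [← extendIndex_shrinkIndex hx hl]
    change ∑ r ∈ Finset.Icc 1 ((shrinkIndex x).1 + 1), _ = t at h
    rw [sum_extendIndex] at h
    omega
  label_ne_zero_iff r := by
    have := hx.label_ne_zero_iff r
    simp only [shrinkIndex, Function.update_apply]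
    split_ifs <;> omega
  label_le r := by
    have h₁ := hx.label_le r
    have h₂ := hx.label_ne_zero_iff r
    have h₃ := hx.label_lt r x.1
    simp only [shrinkIndex, Function.update_apply]
    split_ifs <;> omega
  label_lt r r' h₁ h₂ h₃ := by
    have h := hx.label_lt r r' h₁ h₂
    simp only [shrinkIndex, Function.update_apply] at h₃ ⊢
    split_ifs <;> omega

theorem isChainIndex_succ_iff {k t : ℕ} {x : ℕ × (ℕ → ℕ) × (ℕ → ℕ)} :
    IsChainIndex (k + 1) t x ∧ x.2.2 x.1 ≠ k + 1 ↔ IsChainIndex k t x := by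
  constructor
  · rintro ⟨hx, hne⟩
    refine ⟨hx.1, hx.2, hx.3, fun r => ?_, hx.5⟩
    have h₁ := hx.label_le r
    have h₂ := hx.label_ne_zero_iff r
    have h₃ := hx.label_lt r x.1
    have h₄ := hx.label_le x.1
    by_cases h : r = x.1
    · rw [h]
      omega
    · omega
  · intro hx
    have := hx.label_le x.1
    exact ⟨⟨hx.1, hx.2, hx.3, fun r => (hx.label_le r).trans (Nat.le_succ k), hx.5⟩,
      by omega⟩

theorem sum_chainIndices_succ {M : Type*} [AddCommMonoid M] (k t : ℕ)
    (f : ℕ × (ℕ → ℕ) × (ℕ → ℕ) → M) :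
    ∑ x ∈ chainIndices (k + 1) t, f x = ∑ x ∈ chainIndices k t, f x +
      ∑ a ∈ Finset.Icc 1 t, ∑ x ∈ chainIndices k (t - a), f (extendIndex a (k + 1) x) := by
  rw [← Finset.sum_filter_not_add_sum_filter _ (fun x => x.2.2 x.1 = k + 1)]
  congr 1
  · refine Finset.sum_congr ?_ fun _ _ => rfl
    ext x
    rw [Finset.mem_filter, mem_chainIndices, mem_chainIndices, isChainIndex_succ_iff]
  · rw [Finset.sum_sigma']
    refine Finset.sum_bij' (fun x _ => ⟨x.2.1 1, shrinkIndex x⟩)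
      (fun y _ => extendIndex y.1 (k + 1) y.2) ?_ ?_ ?_ ?_ ?_
    · intro x hx
      rw [Finset.mem_filter, mem_chainIndices] at hx
      have h0 := (hx.1.label_ne_zero_iff x.1).1 (by omega)
      have h₁ := (hx.1.part_ne_zero_iff 1).2 ⟨le_rfl, h0.1⟩
      have h₂ : x.2.1 1 ≤ t := by
        rw [← hx.1.sum_eq]
        exact Finset.single_le_sum (f := x.2.1) (fun _ _ => Nat.zero_le _)
          (Finset.mem_Icc.2 ⟨le_rfl, h0.1⟩)
      rw [Finset.mem_sigma, mem_chainIndices, Finset.mem_Icc]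
      exact ⟨⟨Nat.one_le_iff_ne_zero.2 h₁, h₂⟩, hx.1.shrink hx.2⟩
    · intro y hy
      rw [Finset.mem_sigma, mem_chainIndices, Finset.mem_Icc] at hy
      rw [Finset.mem_filter, mem_chainIndices]
      exact ⟨hy.2.extend hy.1.1 hy.1.2, by simp [extendIndex]⟩
    · intro x hx
      rw [Finset.mem_filter, mem_chainIndices] at hx
      exact extendIndex_shrinkIndex hx.1 hx.2
    · intro y hy
      rw [Finset.mem_sigma, mem_chainIndices] at hy
      exact Sigma.ext (by simp [extendIndex])
        (heq_of_eq (shrinkIndex_extendIndex hy.2))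
    · intro x hx
      rw [Finset.mem_filter, mem_chainIndices] at hx
      rw [extendIndex_shrinkIndex hx.1 hx.2]

theorem chainIndices_zero_right (k : ℕ) : chainIndices k 0 = {(0, 0, 0)} := by
  ext x
  rw [mem_chainIndices, Finset.mem_singleton]
  constructor
  · intro hx
    have h0 : x.1 = 0 := by
      by_contra h
      have h₁ := hx.sum_eq
      rw [Finset.sum_eq_zero_iff] at h₁
      exact (hx.part_ne_zero_iff 1).2 ⟨le_rfl, by omega⟩ (h₁ 1 (Finset.mem_Icc.2 (by omega)))
    refine Prod.ext h0 (Prod.ext ?_ ?_) <;> funext r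
    · have := hx.part_ne_zero_iff r
      simp only [Pi.zero_apply]
      omega
    · have := hx.label_ne_zero_iff r
      simp only [Pi.zero_apply]
      omega
  · rintro rfl
    refine ⟨fun r => ?_, by simp, fun r => ?_, by simp, fun r r' _ _ h => ?_⟩ <;> simp at * <;> omega

theorem chainIndices_zero_left {t : ℕ} (ht : t ≠ 0) : chainIndices 0 t = ∅ := by
  refine Finset.eq_empty_of_forall_notMem fun x hx => ?_
  rw [mem_chainIndices] at hx
  have h₁ := hx.label_le x.1
  have h₂ := hx.label_ne_zero_iff x.1
  have h₃ := hx.sum_eq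
  have h0 : x.1 = 0 := by omega
  rw [h0] at h₃
  exact ht h₃.symm

end Index

section Recursion

variable {A : Type*} [Ring A] {p : ℕ → ℕ} (η : ℕ → Param A p)

/-- The factor `g_x(l − 1) · η_l^{y,n} · g_y(l)⁻¹`, meaningful when `x = y + n`. -/
noncomputable def chainFactor (x y l n : ℕ) : Matrix (Fin (p x)) (Fin (p y)) A :=
  gProd p η x (l - 1) * mcast (p x) (p y) (η l y n) * Ring.inverse (gProd p η y l)

/-- The sum `v 1 + ⋯ + v n`. -/
def partSum (v : ℕ → ℕ) (n : ℕ) : ℕ := ∑ i ∈ Finset.Icc 1 n, v i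

/-- The sizes of the consecutive matrices in the product attached to `x = (ρ, v, j)`. -/
def chainDim (p : ℕ → ℕ) (s : ℕ) (x : ℕ × (ℕ → ℕ) × (ℕ → ℕ)) (r : ℕ) : ℕ :=
  p (s + partSum x.2.1 (x.1 + 1 - r))

/-- The factor of index `r` in the product attached to `x = (ρ, v, j)`. -/
noncomputable def chainLink (s : ℕ) (x : ℕ × (ℕ → ℕ) × (ℕ → ℕ)) (r : ℕ) :
    Matrix (Fin (chainDim p s x r)) (Fin (chainDim p s x (r + 1))) A :=
  mcast _ _ (chainFactor η (s + partSum x.2.1 (x.1 + 1 - r))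
    (s + partSum x.2.1 (x.1 - r)) (x.2.2 r) (x.2.1 (x.1 + 1 - r)))

/-- The summand of the formula attached to the triple `x = (ρ, v, j)`. -/
noncomputable def chainTerm (s t : ℕ) (x : ℕ × (ℕ → ℕ) × (ℕ → ℕ)) :
    Matrix (Fin (p (s + t))) (Fin (p s)) A :=
  mcast _ _ (chainProd (chainDim p s x) (chainLink η s x) 1 x.1)

theorem mcast_chainFactor_congr {a c x x' y y' l l' n n' : ℕ} (hx : x = x') (hy : y = y')
    (hl : l = l') (hn : n = n') :
    mcast a c (chainFactor η x y l n) = mcast a c (chainFactor η x' y' l' n') := by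
  subst hx hy hl hn
  rfl

theorem chainTerm_extendIndex {k s t a : ℕ} (hat : a ≤ t)
    {x : ℕ × (ℕ → ℕ) × (ℕ → ℕ)} (hx : IsChainIndex k (t - a) x) :
    chainTerm η s t (extendIndex a (k + 1) x) =
      mcast (p (s + t)) (p s)
        (chainTerm η (s + a) (t - a) x * chainFactor η (s + a) s (k + 1) a) := by
  have hsum (n : ℕ) : partSum (extendIndex a (k + 1) x).2.1 (n + 1) = a + partSum x.2.1 n :=
    sum_extendIndex a (k + 1) n x
  have hfst : (extendIndex a (k + 1) x).1 = x.1 + 1 := rfl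
  have hzero (v : ℕ → ℕ) : partSum v 0 = 0 := rfl
  have htop : partSum x.2.1 x.1 = t - a := hx.sum_eq
  have hσ (n : ℕ) (hn : 1 ≤ n) : s + partSum (extendIndex a (k + 1) x).2.1 n =
      s + a + partSum x.2.1 (n - 1) := by
    obtain ⟨n, rfl⟩ := Nat.exists_eq_add_of_le' hn
    rw [hsum, Nat.add_sub_cancel, add_assoc]
  have hdim (r : ℕ) (hr₁ : 1 ≤ r) (hr₂ : r ≤ 1 + x.1) :
      chainDim p (s + a) x r = chainDim p s (extendIndex a (k + 1) x) r := by
    unfold chainDim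
    rw [hfst, hσ _ (by omega)]
    congr 3
    omega
  have hprod := chainProd_congr (F := chainLink η s (extendIndex a (k + 1) x))
    (F' := chainLink η (s + a) x) 1 x.1 hdim (fun r h₁ h₂ => by
      unfold chainLink
      rw [mcast_mcast _ (by rfl) (by unfold chainDim; congr 3; omega)]
      apply mcast_chainFactor_congr
      · rw [hfst, hσ _ (by omega)]
        congr 2
        omega
      · rw [hfst, hσ _ (by omega)]
        congr 2
        omega
      · simp only [extendIndex]
        rw [Function.update_of_ne (by omega)]
      · simp only [extendIndex]
        rw [if_neg (by omega), if_neg (by omega)]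
        exact congrArg x.2.1 (by omega))
  have e₁ : chainDim p (s + a) x 1 = p (s + a + (t - a)) := by
    unfold chainDim
    rw [Nat.add_sub_cancel, htop]
  have e₂ : p (s + a + (t - a)) = p (s + t) := by
    congr 1
    omega
  have e₃ : chainDim p (s + a) x (1 + x.1) = p (s + a) := by
    unfold chainDim
    rw [show x.1 + 1 - (1 + x.1) = 0 by omega, hzero, add_zero]
  have e₄ : chainDim p s (extendIndex a (k + 1) x) (1 + x.1 + 1) = p s := by
    unfold chainDim
    rw [hfst, show x.1 + 1 + 1 - (1 + x.1 + 1) = 0 by omega, hzero, add_zero]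
  have hlast : mcast (p (s + a)) (p s)
      (chainLink η s (extendIndex a (k + 1) x) (1 + x.1)) =
        chainFactor η (s + a) s (k + 1) a := by
    unfold chainLink
    have h₁ : (extendIndex a (k + 1) x).1 + 1 - (1 + x.1) = 1 := by
      rw [hfst]
      omega
    have h₂ : (extendIndex a (k + 1) x).1 - (1 + x.1) = 0 := by
      rw [hfst]
      omega
    rw [mcast_mcast _ (by rfl) (by unfold chainDim; congr 3; omega),
      ← mcast_self (chainFactor η (s + a) s _ _)]
    apply mcast_chainFactor_congr
    · rw [h₁, hσ _ le_rfl, Nat.sub_self, hzero, add_zero]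
    · rw [h₂, hzero, add_zero]
    · simp [extendIndex, add_comm]
    · rw [h₁]
      rfl
  have hd₁ := hdim 1 le_rfl (by omega)
  have hd₂ := hdim (1 + x.1) (by omega) le_rfl
  refine (mcast_mul (chainProd _ _ 1 x.1) (chainLink η s (extendIndex a (k + 1) x) (1 + x.1))
    (hd₁.symm.trans (e₁.trans e₂)) (hd₂.symm.trans e₃) e₄).trans ?_
  rw [hlast, hprod,
    mcast_mul_right _ _ e₂, chainTerm, mcast_mcast _ hd₁ hd₂, mcast_mcast _ e₁ e₃]

/-- The sum over all `τ ∈ Δ_t` and `J ∈ J_k(ρ(τ))` in the formula. -/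
noncomputable def chainSum (k s t : ℕ) : Matrix (Fin (p (s + t))) (Fin (p s)) A :=
  ∑ x ∈ chainIndices k t, chainTerm η s t x

theorem chainSum_succ (k s t : ℕ) :
    chainSum η (k + 1) s t = chainSum η k s t + ∑ a ∈ Finset.Icc 1 t,
      mcast (p (s + t)) (p s)
        (chainSum η k (s + a) (t - a) * chainFactor η (s + a) s (k + 1) a) := by
  unfold chainSum
  rw [sum_chainIndices_succ]
  congr 1
  refine Finset.sum_congr rfl fun a ha => ?_
  have hat := (Finset.mem_Icc.1 ha).2
  rw [Matrix.sum_mul, mcast_sum _ _ (by congr 1; omega) rfl]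
  exact Finset.sum_congr rfl fun x hx =>
    chainTerm_extendIndex η hat (mem_chainIndices.1 hx)

theorem chainSum_zero_right (k s : ℕ) :
    chainSum η k s 0 = (1 : Matrix (Fin (p s)) (Fin (p s)) A) := by
  rw [chainSum, chainIndices_zero_right, Finset.sum_singleton]
  exact mcast_self (1 : Matrix (Fin (p s)) (Fin (p s)) A)

theorem chainSum_zero_left (s : ℕ) {t : ℕ} (ht : t ≠ 0) : chainSum η 0 s t = 0 := by
  rw [chainSum, chainIndices_zero_left ht, Finset.sum_empty]

theorem one_add_etaProd_zero (k s : ℕ) :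
    (1 + show Matrix (Fin (p s)) (Fin (p s)) A from etaProd p η k s 0) = gProd p η s k := by
  induction k with
  | zero => exact add_zero _
  | succ k ih =>
    rw [gProd, ← ih]
    change 1 + (etaProd p η k s 0 + η (k + 1) s 0 + ∑ j ∈ Finset.range 1, _) = _
    rw [Finset.sum_range_one]
    have h : mcast (p (s + 0)) (p s) (etaProd p η k (s + 0) (0 - 0) * η (k + 1) s 0) =
      etaProd p η k s 0 * η (k + 1) s 0 := mcast_self _
    rw [h]
    generalize etaProd p η k s 0 = X
    generalize η (k + 1) s 0 = Y
    change Matrix (Fin (p s)) (Fin (p s)) A at X Y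
    change 1 + (X + Y + X * Y) = (1 + X) * (1 + Y)
    noncomm_ring

theorem etaProd_succ (k s : ℕ) {t : ℕ} (ht : 1 ≤ t) :
    etaProd p η (k + 1) s t =
      etaProd p η k s t * (1 + show Matrix (Fin (p s)) (Fin (p s)) A from η (k + 1) s 0) +
        ∑ a ∈ Finset.Ico 1 t,
          mcast (p (s + t)) (p s) (etaProd p η k (s + a) (t - a) * η (k + 1) s a) +
        gProd p η (s + t) k * η (k + 1) s t := by
  change etaProd p η k s t + η (k + 1) s t + ∑ j ∈ Finset.range (t + 1), _ = _
  have hz : mcast (p (s + t)) (p s) (etaProd p η k (s + 0) (t - 0) * η (k + 1) s 0) =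
      etaProd p η k s t *
        (show Matrix (Fin (p s)) (Fin (p s)) A from η (k + 1) s 0) := mcast_self _
  have hl : mcast (p (s + t)) (p s) (etaProd p η k (s + t) (t - t) * η (k + 1) s t) =
      (show Matrix (Fin (p (s + t))) (Fin (p (s + t))) A from etaProd p η k (s + t) 0) *
        η (k + 1) s t := by
    rw [Nat.sub_self]
    exact mcast_self _
  rw [Finset.sum_range_succ, Finset.range_eq_Ico, Finset.sum_eq_sum_Ico_succ_bot (by omega),
    hz, hl, ← one_add_etaProd_zero, Matrix.mul_add, Matrix.mul_one, Matrix.add_mul,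
    Matrix.one_mul]
  abel

theorem isUnit_gProd {k s : ℕ}
    (h : ∀ j, 1 ≤ j → j ≤ k →
      IsUnit (1 + show Matrix (Fin (p s)) (Fin (p s)) A from η j s 0)) :
    IsUnit (gProd p η s k) := by
  induction k with
  | zero => exact isUnit_one
  | succ k ih =>
    exact (ih fun j h₁ h₂ => h j h₁ (by omega)).mul (h (k + 1) (by omega) le_rfl)

theorem etaProd_eq_chainSum_mul (k s : ℕ) {t : ℕ} (ht : 1 ≤ t)
    (hunit : ∀ j s : ℕ, 1 ≤ j → j ≤ k →
      IsUnit (1 + show Matrix (Fin (p s)) (Fin (p s)) A from η j s 0)) :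
    etaProd p η k s t = chainSum η k s t * gProd p η s k := by
  induction k generalizing s t with
  | zero =>
    rw [chainSum_zero_left η s (by omega), Matrix.zero_mul]
    rfl
  | succ k ih =>
    replace ih := fun s t ht => ih (s := s) (t := t) ht
      fun j s h₁ h₂ => hunit j s h₁ (by omega)
    have hg := isUnit_gProd η (s := s) fun j => hunit j s
    have hfactor (a : ℕ) : chainFactor η (s + a) s (k + 1) a * gProd p η s (k + 1) =
        gProd p η (s + a) k * η (k + 1) s a := by
      rw [chainFactor, Matrix.mul_assoc, Ring.inverse_mul_cancel _ hg, Matrix.mul_one,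
        mcast_self, Nat.add_sub_cancel]
    rw [etaProd_succ η k s ht, chainSum_succ, Matrix.add_mul, ih s t ht, Matrix.mul_assoc,
      Matrix.sum_mul, add_assoc]
    congr 1
    rw [← Finset.Ico_succ_right_eq_Icc, Nat.succ_eq_succ, Finset.sum_Ico_succ_top ht]
    congr 1
    · refine Finset.sum_congr rfl fun a ha => ?_
      have ha := Finset.mem_Ico.1 ha
      have e : p (s + a + (t - a)) = p (s + t) := by
        congr 1
        omega
      rw [← mcast_mul_right _ _ e, Matrix.mul_assoc, hfactor, ih (s + a) (t - a) (by omega),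
        Matrix.mul_assoc]
    · rw [Nat.sub_self, chainSum_zero_right]
      symm
      change mcast (p (s + t)) (p s)
        ((1 : Matrix (Fin (p (s + t))) (Fin (p (s + t))) A) * _) * _ = _
      rw [Matrix.one_mul, mcast_self, hfactor]

end Recursion

/-- Lemma 3.2, formula (5) of the paper: if every g_{s,j} = I + η_j^{s,0}
    is invertible, then for 0 ≤ s ≤ m and 1 ≤ t ≤ m − s,
    η(k)^{s,t} = ( Σ_{τ ∈ Δ_t} Σ_{J ∈ J_k(ρ(τ))} ∏_{r=1}^{ρ(τ)}
      g_{s+σ'(τ,r)}(j_r − 1) · η_{j_r}^{s+σ(τ,r), τ_{ρ(τ)+1−r}} · g_{s+σ(τ,r)}(j_r)⁻¹ )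
      · g_s(k),
    the product over r being taken in increasing order. -/
theorem etaProd_formula {A : Type*} [Ring A] (m : ℕ) (p : ℕ → ℕ) (hp : ∀ s, 0 < p s)
    (k : ℕ) (hk : 1 ≤ k) (η : ℕ → Param A p) (hη : ∀ j, InRange m (η j))
    (hunit : ∀ j s : ℕ, 1 ≤ j → j ≤ k →
      IsUnit (1 + show Matrix (Fin (p s)) (Fin (p s)) A from η j s 0))
    (s t : ℕ) (hs : s ≤ m) (ht : 1 ≤ t) (htm : t ≤ m - s) :
    etaProd p η k s t =
      (∑ τ ∈ DeltaSet t, ∑ J ∈ Jset k (rhoOf τ),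
          mcast (p (s + t)) (p s)
            (chainProd (fun r => p (s + sigma' τ r))
              (fun r =>
                mcast (p (s + sigma' τ r)) (p (s + sigma' τ (r + 1)))
                  (gProd p η (s + sigma' τ r) (jval J r - 1) *
                    mcast (p (s + sigma' τ r)) (p (s + sigmaOf τ r))
                      (η (jval J r) (s + sigmaOf τ r) (tval τ (rhoOf τ + 1 - r))) *
                    Ring.inverse (gProd p η (s + sigmaOf τ r) (jval J r))))
              1 (rhoOf τ))) *
        gProd p η s k := by
  rw [etaProd_eq_chainSum_mul η k s ht hunit, chainSum, sum_chainIndices]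
  rfl
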